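/- For every ν ∈ ℝ there is a constant C such that every holomorphic function F on T_Λ satisfies sup_{z ∈ T_Λ} Δ(Im z)^{ν+1} |□F(z)| ≤ C sup_{z ∈ T_Λ} Δ(Im z)^ν |F(z)|. -/

import Mathlib

open MeasureTheory Complex Set
open scoped ENNReal

noncomputable section

/-- The Lorentz form `Δ(y) = y₁² − y₂² − ⋯ − yₙ²` on `ℝⁿ`
(written as `2 y₀² − ∑ yᵢ²` with 0-based indexing). -/
def lor {n : ℕ} [NeZero n] (y : Fin n → ℝ) : ℝ := 2 * y 0 ^ 2 - ∑ i, y i ^ 2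

/-- The holomorphic extension of the Lorentz form to `ℂⁿ`. -/
def lorC {n : ℕ} [NeZero n] (z : Fin n → ℂ) : ℂ := 2 * z 0 ^ 2 - ∑ i, z i ^ 2

/-- Componentwise imaginary part. -/
def imP {n : ℕ} (z : Fin n → ℂ) : Fin n → ℝ := fun i => (z i).im

/-- The forward light cone `Λ`. -/
def cone (n : ℕ) [NeZero n] : Set (Fin n → ℝ) := {y | 0 < lor y ∧ 0 < y 0}

/-- The tube domain `T_Λ` over the forward light cone. -/
def tube (n : ℕ) [NeZero n] : Set (Fin n → ℂ) := {z | imP z ∈ cone n}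

/-- The weighted measure `dV_ν = Δ(Im z)^{ν − n/2} dz` on `T_Λ`. -/
def dV (n : ℕ) [NeZero n] (ν : ℝ) : Measure (Fin n → ℂ) :=
  ((volume : Measure (Fin n → ℂ)).restrict (tube n)).withDensity
    (fun z => ENNReal.ofReal (lor (imP z) ^ (ν - (n : ℝ) / 2)))

/-- `∫ |F|^p dV_ν` (as an extended nonnegative real). -/
def lpInt (n : ℕ) [NeZero n] (p ν : ℝ) (F : (Fin n → ℂ) → ℂ) : ℝ≥0∞ :=
  ∫⁻ z, ENNReal.ofReal (‖F z‖ ^ p) ∂(dV n ν)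

/-- The `L^p_ν` norm `(∫ |F|^p dV_ν)^{1/p}`. -/
def lpNorm (n : ℕ) [NeZero n] (p ν : ℝ) (F : (Fin n → ℂ) → ℂ) : ℝ≥0∞ :=
  (lpInt n p ν F) ^ (1 / p)

/-- The Bergman space `A^p_ν`: holomorphic on `T_Λ` and in `L^p_ν`. -/
def memA (n : ℕ) [NeZero n] (p ν : ℝ) (F : (Fin n → ℂ) → ℂ) : Prop :=
  DifferentiableOn ℂ F (tube n) ∧ lpInt n p ν F < ⊤

/-- Partial derivative `∂/∂zᵢ`. -/
def pd {n : ℕ} (i : Fin n) (F : (Fin n → ℂ) → ℂ) : (Fin n → ℂ) → ℂ :=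
  fun z => fderiv ℂ F z (Pi.single i 1)

/-- The wave (Box) operator `□ = −(∂₁² − ∂₂² − ⋯ − ∂ₙ²)`, so that
`□ e^{i z·ξ} = Δ(ξ) e^{i z·ξ}`. -/
def BoxOp {n : ℕ} [NeZero n] (F : (Fin n → ℂ) → ℂ) : (Fin n → ℂ) → ℂ :=
  fun z => -(2 * pd 0 (pd 0 F) z - ∑ i, pd i (pd i F) z)

/-- The (unnormalized) Bergman kernel `B_β(z,w) = Δ((z − w̄)/i)^{−(β+n)}`. -/
def berg (n : ℕ) [NeZero n] (β : ℝ) (z w : Fin n → ℂ) : ℂ :=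
  lorC (fun i => (z i - (starRingEnd ℂ) (w i)) / Complex.I) ^ (-(β + (n : ℝ)) : ℂ)

/-- The Hardy inequality holds for `(p, ν)`:
`∫ |F|^p dV_ν ≤ C ∫ |Δ(Im z) □F(z)|^p dV_ν(z)` for all `F ∈ A^p_ν`. -/
def hardy (n : ℕ) [NeZero n] (p ν : ℝ) : Prop :=
  ∃ C > (0 : ℝ), ∀ F, memA n p ν F →
    lpInt n p ν F ≤ ENNReal.ofReal C *
      lpInt n p ν (fun z => (lor (imP z) : ℂ) * BoxOp F z)

/-- `g` is the orthogonal projection of `f ∈ L²_ν` onto the closed subspace `A²_ν`: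
`g ∈ A²_ν` and `f − g ⊥ A²_ν`. -/
def isProj (n : ℕ) [NeZero n] (ν : ℝ) (f g : (Fin n → ℂ) → ℂ) : Prop :=
  memA n 2 ν g ∧ ∀ h, memA n 2 ν h →
    ∫ z, f z * (starRingEnd ℂ) (h z) ∂(dV n ν) =
      ∫ z, g z * (starRingEnd ℂ) (h z) ∂(dV n ν)

/-- The Bergman projection `P_ν` admits a bounded extension to `L^p_ν`:
`‖P_ν f‖_{L^p_ν} ≤ C ‖f‖_{L^p_ν}` for all `f ∈ L²_ν ∩ L^p_ν`. -/
def projBounded (n : ℕ) [NeZero n] (p ν : ℝ) : Prop :=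
  ∃ C > (0 : ℝ), ∀ f g : (Fin n → ℂ) → ℂ,
    AEStronglyMeasurable f (dV n ν) → lpInt n 2 ν f < ⊤ → lpInt n p ν f < ⊤ →
    isProj n ν f g → lpNorm n p ν g ≤ ENNReal.ofReal C * lpNorm n p ν f

/-- A bounded (continuous) linear functional on `A^p_ν`. -/
def isBddFunc (n : ℕ) [NeZero n] (p ν : ℝ) (γ : ((Fin n → ℂ) → ℂ) → ℂ) : Prop :=
  (∀ F G, memA n p ν F → memA n p ν G → γ (F + G) = γ F + γ G) ∧
  (∀ (c : ℂ) (F), memA n p ν F → γ (fun z => c * F z) = c * γ F) ∧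
  ∃ C : ℝ, ∀ F, memA n p ν F → ‖γ F‖ ≤ C * (lpNorm n p ν F).toReal

/-- The first derivatives of a holomorphic function of several variables are locally bounded. -/
lemma norm_fderiv_bounded_near {E : Type*} [NormedAddCommGroup E] [NormedSpace ℂ E]
    {U : Set E} (hU : IsOpen U) {F : E → ℂ} (hF : DifferentiableOn ℂ F U) {x₀ : E} (hx₀ : x₀ ∈ U) :
    ∃ R > 0, ∃ M, Metric.ball x₀ R ⊆ U ∧ ∀ x ∈ Metric.ball x₀ R, ‖fderiv ℂ F x‖ ≤ M := by
  have hc : ContinuousAt F x₀ := (hF.differentiableAt (hU.mem_nhds hx₀)).continuousAt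
  obtain ⟨R, hR, hsub⟩ := Metric.mem_nhds_iff.1
    (Filter.inter_mem (hU.mem_nhds hx₀) (hc (Metric.ball_mem_nhds (F x₀) one_pos)))
  refine ⟨R / 2, by positivity, 2 / (R / 2),
    (Metric.ball_subset_ball (by linarith)).trans fun y hy ↦ (hsub hy).1, fun x hx ↦ ?_⟩
  have hxR : Metric.ball x (R / 2) ⊆ Metric.ball x₀ R := by
    intro y hy
    have := dist_triangle y x x₀
    simp only [Metric.mem_ball] at *
    linarith
  refine Complex.norm_fderiv_le_div_of_mapsTo_ball
    (hF.mono fun y hy ↦ (hsub (hxR hy)).1) (fun y hy ↦ ?_) (by positivity)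
  have h1 : dist (F y) (F x₀) < 1 := (hsub (hxR hy)).2
  have h2 : dist (F x) (F x₀) < 1 := (hsub (hxR (Metric.mem_ball_self (by positivity)))).2
  have := dist_triangle_right (F y) (F x) (F x₀)
  simp only [Metric.mem_closedBall]
  linarith

/-- A directional derivative of a holomorphic function of several variables is holomorphic. -/
lemma differentiableOn_fderiv_apply {E : Type*} [NormedAddCommGroup E] [NormedSpace ℂ E]
    [FiniteDimensional ℂ E] {U : Set E} (hU : IsOpen U) {F : E → ℂ}
    (hF : DifferentiableOn ℂ F U) (v : E) :
    DifferentiableOn ℂ (fun x ↦ fderiv ℂ F x v) U := by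
  intro x₀ hx₀
  obtain ⟨R, hR, M, hRU, hM⟩ := norm_fderiv_bounded_near hU hF hx₀
  have hv : 0 < ‖v‖ + 1 := by positivity
  set r : ℝ := R / (2 * (‖v‖ + 1)) with hr
  have hr0 : 0 < r := by positivity
  have hrv : r * ‖v‖ ≤ R / 2 := by
    rw [hr, div_mul_eq_mul_div, div_le_div_iff₀ (by positivity) (by positivity)]
    nlinarith
  have hmem : ∀ x ∈ Metric.ball x₀ (R / 2), ∀ ζ : ℂ, ‖ζ‖ ≤ r →
      x + ζ • v ∈ Metric.ball x₀ R := by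
    intro x hx ζ hζ
    rw [Metric.mem_ball, dist_eq_norm] at *
    calc ‖x + ζ • v - x₀‖ = ‖(x - x₀) + ζ • v‖ := by congr 1; abel
      _ ≤ ‖x - x₀‖ + ‖ζ‖ * ‖v‖ := by rw [← norm_smul]; exact norm_add_le _ _
      _ < R := by nlinarith [norm_nonneg v]
  have hFd : ∀ x ∈ Metric.ball x₀ R, DifferentiableAt ℂ F x := fun x hx ↦
    hF.differentiableAt (hU.mem_nhds (hRU hx))
  set k : ℝ → ℂ := fun θ ↦ deriv (circleMap 0 r) θ * (1 / circleMap 0 r θ ^ 2) with hk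
  have hk_cont : Continuous k := by
    have h0 : ∀ θ, circleMap 0 r θ ^ 2 ≠ 0 := fun θ ↦
      pow_ne_zero 2 (circleMap_ne_center hr0.ne')
    simp only [hk, deriv_circleMap]
    fun_prop (disch := exact h0 _)
  have hcirc : ∀ θ, ‖circleMap 0 r θ‖ ≤ r := fun θ ↦ by simp [abs_of_pos hr0]
  have hformula : ∀ x ∈ Metric.ball x₀ (R / 2), fderiv ℂ F x v =
      (2 * Real.pi * Complex.I : ℂ)⁻¹ *
        ∫ θ in (0 : ℝ)..2 * Real.pi, k θ • F (x + circleMap 0 r θ • v) := by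
    intro x hx
    have hline : ∀ ζ : ℂ, HasDerivAt (fun ζ : ℂ ↦ x + ζ • v) v ζ := fun ζ ↦ by
      simpa using ((hasDerivAt_id ζ).smul_const v).const_add x
    have hd : DifferentiableOn ℂ (fun ζ : ℂ ↦ F (x + ζ • v)) (Metric.closedBall 0 r) := by
      intro ζ hζ
      exact ((hFd _ (hmem x hx ζ (by simpa using hζ))).comp ζ
        (hline ζ).differentiableAt).differentiableWithinAt
    have h1 := hd.deriv_eq_smul_circleIntegral hr0
    have h2 : deriv (fun ζ : ℂ ↦ F (x + ζ • v)) 0 = fderiv ℂ F x v := by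
      have := (hFd _ (hmem x hx 0 (by simpa using hr0.le))).hasFDerivAt.comp_hasDerivAt
        (0 : ℂ) (hline 0)
      simpa [Function.comp_def] using this.deriv
    rw [h2] at h1
    have h3 : (2 * Real.pi * Complex.I : ℂ) ≠ 0 := Complex.two_pi_I_ne_zero
    rw [eq_inv_mul_iff_mul_eq₀ h3, ← smul_eq_mul, ← h1, circleIntegral]
    simp [hk, mul_assoc]
  have hcont : ∀ x ∈ Metric.ball x₀ (R / 2),
      Continuous fun θ : ℝ ↦ k θ • F (x + circleMap 0 r θ • v) := by
    intro x hx
    refine hk_cont.smul (continuous_iff_continuousAt.2 fun θ ↦ ?_)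
    have h4 : ContinuousAt (fun θ : ℝ ↦ x + circleMap 0 r θ • v) θ := by fun_prop
    exact ContinuousAt.comp (f := fun θ : ℝ ↦ x + circleMap 0 r θ • v)
      (hFd _ (hmem x hx _ (hcirc θ))).continuousAt h4
  have hx₀' : x₀ ∈ Metric.ball x₀ (R / 2) := Metric.mem_ball_self (by positivity)
  have hnhds : Metric.ball x₀ (R / 2) ∈ nhds x₀ := Metric.ball_mem_nhds _ (by positivity)
  have hint := intervalIntegral.hasFDerivAt_integral_of_dominated_of_fderiv_le
    (𝕜 := ℂ) (μ := volume) (a := 0) (b := 2 * Real.pi) (x₀ := x₀)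
    (s := Metric.ball x₀ (R / 2)) (bound := fun θ ↦ ‖k θ‖ * M)
    (F := fun x θ ↦ k θ • F (x + circleMap 0 r θ • v))
    (F' := fun x θ ↦ k θ • fderiv ℂ F (x + circleMap 0 r θ • v)) hnhds
    (Filter.eventually_of_mem hnhds fun x hx ↦ (hcont x hx).aestronglyMeasurable)
    ((hcont x₀ hx₀').intervalIntegrable _ _)
    (by
      borelize E
      have : FiniteDimensional ℂ (E →L[ℂ] ℂ) := inferInstance
      have : ProperSpace (E →L[ℂ] ℂ) := FiniteDimensional.proper ℂ _
      have : SecondCountableTopology (E →L[ℂ] ℂ) := inferInstance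
      have hm : Measurable fun θ : ℝ ↦ fderiv ℂ F (x₀ + circleMap 0 r θ • v) :=
        (measurable_fderiv ℂ F).comp (by fun_prop : Continuous fun θ : ℝ ↦
          x₀ + circleMap 0 r θ • v).measurable
      exact hk_cont.aestronglyMeasurable.smul hm.aestronglyMeasurable)
    (Filter.Eventually.of_forall fun θ _ x hx ↦ by
      rw [norm_smul]
      exact mul_le_mul_of_nonneg_left (hM _ (hmem x hx _ (hcirc θ))) (norm_nonneg _))
    ((hk_cont.norm.mul continuous_const).intervalIntegrable _ _)
    (Filter.Eventually.of_forall fun θ _ x hx ↦ by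
      have h5 : HasFDerivAt (fun y : E ↦ y + circleMap 0 r θ • v) (ContinuousLinearMap.id ℂ E) x :=
        (hasFDerivAt_id x).add_const _
      exact ((hFd _ (hmem x hx _ (hcirc θ))).hasFDerivAt.comp x h5).const_smul (k θ))
  refine DifferentiableAt.differentiableWithinAt ?_
  refine (hint.differentiableAt.const_mul ((2 * Real.pi * Complex.I : ℂ)⁻¹)).congr_of_eventuallyEq ?_
  exact Filter.eventually_of_mem hnhds hformula

/-- The second derivative at `z` as a bilinear map, built from iterated directional derivatives. -/
def secondDeriv {E : Type*} [NormedAddCommGroup E] [NormedSpace ℂ E] [FiniteDimensional ℂ E]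
    {U : Set E} (hU : IsOpen U) {F : E → ℂ} (hF : DifferentiableOn ℂ F U) {z : E} (hz : z ∈ U) :
    E →ₗ[ℂ] E →L[ℂ] ℂ where
  toFun v := fderiv ℂ (fun x ↦ fderiv ℂ F x v) z
  map_add' v w := by
    have h (v : E) := (differentiableOn_fderiv_apply hU hF v).differentiableAt (hU.mem_nhds hz)
    simp only [map_add]
    exact fderiv_fun_add (h v) (h w)
  map_smul' c v := by
    have h := (differentiableOn_fderiv_apply hU hF v).differentiableAt (hU.mem_nhds hz)
    simp only [map_smul, RingHom.id_apply]
    exact fderiv_fun_const_smul h c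

/-- Cauchy's estimate for the second derivative in the direction `v`. -/
lemma norm_secondDeriv_le {E : Type*} [NormedAddCommGroup E] [NormedSpace ℂ E]
    [FiniteDimensional ℂ E] {U : Set E} (hU : IsOpen U) {F : E → ℂ}
    (hF : DifferentiableOn ℂ F U) {z : E} (hz : z ∈ U) (v : E) {r K : ℝ} (hr : 0 < r)
    (hmem : ∀ ζ : ℂ, ‖ζ‖ ≤ r → z + ζ • v ∈ U) (hK : ∀ ζ : ℂ, ‖ζ‖ ≤ r → ‖F (z + ζ • v)‖ ≤ K) :
    ‖secondDeriv hU hF hz v v‖ ≤ 2 * K / r ^ 2 := by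
  have hline : ∀ ζ : ℂ, HasDerivAt (fun ζ : ℂ ↦ z + ζ • v) v ζ := fun ζ ↦ by
    simpa using ((hasDerivAt_id ζ).smul_const v).const_add z
  have key : ∀ G : E → ℂ, DifferentiableOn ℂ G U → ∀ ζ : ℂ, ‖ζ‖ ≤ r →
      HasDerivAt (fun ζ : ℂ ↦ G (z + ζ • v)) (fderiv ℂ G (z + ζ • v) v) ζ := fun G hG ζ hζ ↦
    (hG.differentiableAt (hU.mem_nhds (hmem ζ hζ))).hasFDerivAt.comp_hasDerivAt ζ (hline ζ)
  have hd : DiffContOnCl ℂ (fun ζ : ℂ ↦ F (z + ζ • v)) (Metric.ball 0 r) := by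
    refine DifferentiableOn.diffContOnCl_ball (U := Metric.closedBall 0 r) ?_ subset_rfl
    exact fun ζ hζ ↦ (key F hF ζ (by simpa using hζ)).differentiableAt.differentiableWithinAt
  have hC := Complex.norm_iteratedDeriv_le_of_forall_mem_sphere_norm_le 2 hr hd
    (C := K) fun ζ hζ ↦ hK ζ (by simpa using hζ.le)
  have h2 : iteratedDeriv 2 (fun ζ : ℂ ↦ F (z + ζ • v)) 0 = secondDeriv hU hF hz v v := by
    rw [iteratedDeriv_succ, iteratedDeriv_one]
    have hev : deriv (fun ζ : ℂ ↦ F (z + ζ • v)) =ᶠ[nhds 0] fun ζ ↦ fderiv ℂ F (z + ζ • v) v := by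
      refine Filter.eventually_of_mem (Metric.closedBall_mem_nhds (0 : ℂ) hr) fun ζ hζ ↦ ?_
      exact (key F hF ζ (by simpa using hζ)).deriv
    rw [hev.deriv_eq]
    have := (key _ (differentiableOn_fderiv_apply hU hF v) 0 (by simpa using hr.le)).deriv
    simpa [secondDeriv] using this
  rw [h2] at hC
  simpa using hC

/-- The coefficient in the Lorentz reflection `boost u`. -/
def boostCoeff {n : ℕ} [NeZero n] (u : Fin n → ℝ) (i : Fin n) : ℝ :=
  if i = 0 then 1 else -(u i / (1 + u 0))

/-- The image of the `i`-th standard basis vector under the Lorentz reflection exchanging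
`e₀` and `-u`, for a unit timelike vector `u`. -/
def boost {n : ℕ} [NeZero n] (u : Fin n → ℝ) (i : Fin n) : Fin n → ℝ :=
  Pi.single i 1 - boostCoeff u i • (Pi.single 0 1 + u)

/-- The Lorentz inner product. -/
def lorInner {n : ℕ} [NeZero n] (x y : Fin n → ℝ) : ℝ := 2 * (x 0 * y 0) - ∑ i, x i * y i

section LorentzAlgebra

variable {n : ℕ} [NeZero n]

lemma lor_eq_lorInner (y : Fin n → ℝ) : lor y = lorInner y y := by
  simp [lor, lorInner, sq]

lemma lorInner_comm (x y : Fin n → ℝ) : lorInner x y = lorInner y x := by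
  simp [lorInner, mul_comm]

lemma lorInner_add_left (x x' y : Fin n → ℝ) :
    lorInner (x + x') y = lorInner x y + lorInner x' y := by
  simp only [lorInner, Pi.add_apply, add_mul, Finset.sum_add_distrib]
  ring

lemma lorInner_smul_left (c : ℝ) (x y : Fin n → ℝ) :
    lorInner (c • x) y = c * lorInner x y := by
  simp only [lorInner, Pi.smul_apply, smul_eq_mul, mul_assoc, ← Finset.mul_sum]
  ring

lemma lorInner_add_right (x y y' : Fin n → ℝ) :
    lorInner x (y + y') = lorInner x y + lorInner x y' := by
  rw [lorInner_comm, lorInner_add_left, lorInner_comm y, lorInner_comm y']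

lemma lorInner_smul_right (c : ℝ) (x y : Fin n → ℝ) :
    lorInner x (c • y) = c * lorInner x y := by
  rw [lorInner_comm, lorInner_smul_left, lorInner_comm]

lemma lorInner_single (x : Fin n → ℝ) (i : Fin n) :
    lorInner x (Pi.single i 1) = if i = 0 then x 0 else -x i := by
  by_cases hi : i = 0
  · subst hi
    simp [lorInner, Pi.single_apply]
    ring
  · simp [lorInner, Pi.single_apply, hi, Ne.symm hi]

lemma lor_add_smul (y w : Fin n → ℝ) (t : ℝ) :
    lor (y + t • w) = lor y + 2 * t * lorInner y w + t ^ 2 * lor w := by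
  simp only [lor_eq_lorInner, lorInner_add_left, lorInner_add_right, lorInner_smul_left,
    lorInner_smul_right, lorInner_comm w y]
  ring

lemma boost_zero (u : Fin n → ℝ) : boost u 0 = -u := by
  simp [boost, boostCoeff]

lemma boost_of_ne_zero (u : Fin n → ℝ) {i : Fin n} (hi : i ≠ 0) :
    boost u i = Pi.single i 1 + (u i / (1 + u 0)) • (Pi.single 0 1 + u) := by
  simp only [boost, boostCoeff, if_neg hi, neg_smul, sub_neg_eq_add]

lemma boost_apply_zero {u : Fin n → ℝ} (hu0 : 0 < u 0) {i : Fin n} (hi : i ≠ 0) :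
    boost u i 0 = u i := by
  have h : 1 + u 0 ≠ 0 := by positivity
  simp [boost_of_ne_zero u hi, Ne.symm hi]
  field_simp

lemma lorInner_boost {u : Fin n → ℝ} (hu : lor u = 1) (hu0 : 0 < u 0) {i : Fin n} (hi : i ≠ 0) :
    lorInner u (boost u i) = 0 := by
  have h : 1 + u 0 ≠ 0 := by positivity
  rw [boost_of_ne_zero u hi, lorInner_add_right, lorInner_smul_right, lorInner_add_right,
    lorInner_single, lorInner_single, ← lor_eq_lorInner, hu, if_neg hi, if_pos rfl]
  field_simp
  ring

lemma lor_boost {u : Fin n → ℝ} (hu : lor u = 1) (hu0 : 0 < u 0) {i : Fin n} (hi : i ≠ 0) :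
    lor (boost u i) = -1 := by
  have h : 1 + u 0 ≠ 0 := by positivity
  rw [boost_of_ne_zero u hi, lor_add_smul]
  have h1 : lor (Pi.single i 1 : Fin n → ℝ) = -1 := by
    rw [lor_eq_lorInner, lorInner_single, if_neg hi]; simp
  have h2 : lorInner (Pi.single i 1) (Pi.single 0 1 + u) = -u i := by
    rw [lorInner_comm, lorInner_single, if_neg hi]; simp [hi]
  have h3 : lor (Pi.single 0 1 + u : Fin n → ℝ) = 2 * (1 + u 0) := by
    have := lor_add_smul u (Pi.single 0 1) 1
    rw [one_smul, lorInner_single, if_pos rfl, hu] at this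
    rw [add_comm, this, lor_eq_lorInner, lorInner_single]
    simp; ring
  rw [h1, h2, h3]
  field_simp
  ring

lemma abs_apply_le_apply_zero {u : Fin n → ℝ} (hu : lor u = 1) (hu0 : 0 < u 0) (i : Fin n) :
    |u i| ≤ u 0 := by
  by_cases hi : i = 0
  · rw [hi, abs_of_pos hu0]
  refine abs_le_of_sq_le_sq ?_ hu0.le
  have h : u 0 ^ 2 + u i ^ 2 ≤ ∑ j, u j ^ 2 := by
    rw [← Finset.sum_pair (f := fun j ↦ u j ^ 2) (Ne.symm hi)]
    exact Finset.sum_le_sum_of_subset_of_nonneg (Finset.subset_univ _) fun _ _ _ ↦ sq_nonneg _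
  unfold lor at hu
  linarith

/-- Moving from a point of the cone by at most half of the Lorentz distance along a boosted frame
stays in the cone and changes the Lorentz form by a bounded factor. -/
lemma lor_add_smul_boost {u : Fin n → ℝ} (hu : lor u = 1) (hu0 : 0 < u 0) (i : Fin n)
    {s t : ℝ} (hs : 0 < s) (ht : |t| ≤ s / 2) :
    s • u + t • boost u i ∈ cone n ∧ s ^ 2 / 4 ≤ lor (s • u + t • boost u i) ∧
      lor (s • u + t • boost u i) ≤ 4 * s ^ 2 := by
  obtain ⟨ht1, ht2⟩ := abs_le.1 ht
  have hsu : lor (s • u) = s ^ 2 := by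
    rw [lor_eq_lorInner, lorInner_smul_left, lorInner_smul_right, ← lor_eq_lorInner, hu]; ring
  have hval : s ^ 2 / 4 ≤ lor (s • u + t • boost u i) ∧
      lor (s • u + t • boost u i) ≤ 4 * s ^ 2 := by
    rw [lor_add_smul, hsu, lorInner_smul_left]
    by_cases hi : i = 0
    · subst hi
      have h1 : lorInner u (-u) = -1 := by
        rw [← neg_one_smul ℝ u, lorInner_smul_right, ← lor_eq_lorInner, hu]; ring
      have h2 : lor (-u) = 1 := by simpa [lor] using hu
      rw [boost_zero, h1, h2]
      constructor <;> nlinarith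
    · rw [lorInner_boost hu hu0 hi, lor_boost hu hu0 hi]
      constructor <;> nlinarith
  refine ⟨⟨lt_of_lt_of_le (by positivity) hval.1, ?_⟩, hval⟩
  have hb : |boost u i 0| ≤ u 0 := by
    by_cases hi : i = 0
    · subst hi
      rw [boost_zero, Pi.neg_apply, abs_neg, abs_of_pos hu0]
    · rw [boost_apply_zero hu0 hi]
      exact abs_apply_le_apply_zero hu hu0 i
  have h1 : |t * boost u i 0| ≤ s / 2 * u 0 := by
    rw [abs_mul]
    exact mul_le_mul ht hb (abs_nonneg _) (by positivity)
  have h2 := (abs_le.1 h1).1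
  simp only [Pi.add_apply, Pi.smul_apply, smul_eq_mul]
  nlinarith [mul_pos hs hu0]

/-- The trace of a bilinear form with respect to the Lorentz metric is invariant under `boost`. -/
lemma boost_trace (B : (Fin n → ℂ) →ₗ[ℂ] (Fin n → ℂ) →L[ℂ] ℂ) {u : Fin n → ℝ} (hu : lor u = 1)
    (hu0 : 0 < u 0) :
    2 * B (fun j ↦ boost u 0 j) (fun j ↦ boost u 0 j) -
        ∑ i, B (fun j ↦ boost u i j) (fun j ↦ boost u i j) =
      2 * B (Pi.single 0 1) (Pi.single 0 1) - ∑ i, B (Pi.single i 1) (Pi.single i 1) := by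
  have hk : 1 + u 0 ≠ 0 := by positivity
  have hkC : (1 + u 0 : ℂ) ≠ 0 := by exact_mod_cast hk
  set e : Fin n → Fin n → ℂ := fun i ↦ Pi.single i 1 with he
  set v : Fin n → ℂ := e 0 + fun j ↦ (u j : ℂ) with hv
  set c : Fin n → ℂ := fun i ↦ (boostCoeff u i : ℂ) with hc
  have hb : ∀ i, (fun j ↦ (boost u i j : ℂ)) = e i - c i • v := by
    intro i
    ext j
    simp only [boost, he, hv, hc, Pi.sub_apply, Pi.smul_apply, Pi.add_apply, smul_eq_mul,
      Pi.single_apply]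
    push_cast
    split_ifs <;> simp
  have hc0 : c 0 = 1 := by simp [hc, boostCoeff]
  have hci : ∀ i, c i = (2 * (if i = 0 then 1 + (u 0 : ℂ) else 0) - v i) / (1 + u 0) := by
    intro i
    by_cases hi : i = 0
    · subst hi
      rw [hc0]
      simp [hv, he]
      field_simp
      ring
    · simp [hc, boostCoeff, hi, hv, he]
      ring
  have hsumc : 2 * c 0 • e 0 - ∑ i, c i • e i = ((1 + u 0 : ℂ))⁻¹ • v := by
    ext j
    have h1 : (∑ i, c i • e i) j = c j := by
      simp [Finset.sum_apply, he, Pi.single_apply]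
    rw [Pi.sub_apply, h1, hci j, hc0]
    by_cases hj : j = 0
    · subst hj
      simp [he]
      field_simp
      ring
    · simp [he, hj]
      field_simp
  have hsq : 2 * c 0 ^ 2 - ∑ i, c i ^ 2 = 2 * (1 + u 0 : ℂ)⁻¹ := by
    have hr : 2 * boostCoeff u 0 ^ 2 - ∑ i, boostCoeff u i ^ 2 = 2 * (1 + u 0)⁻¹ := by
      have h1 : ∑ i, boostCoeff u i ^ 2 =
          1 + (∑ i, u i ^ 2 - u 0 ^ 2) / (1 + u 0) ^ 2 := by
        rw [← Finset.add_sum_erase _ _ (Finset.mem_univ (0 : Fin n)),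
          ← Finset.add_sum_erase _ (fun i ↦ u i ^ 2) (Finset.mem_univ (0 : Fin n)),
          add_sub_cancel_left, Finset.sum_div]
        congr 1
        · simp [boostCoeff]
        · refine Finset.sum_congr rfl fun i hi ↦ ?_
          simp [boostCoeff, Finset.ne_of_mem_erase hi, div_pow]
      have h2 : ∑ i, u i ^ 2 = 2 * u 0 ^ 2 - 1 := by
        unfold lor at hu; linarith
      rw [h1, h2]
      simp only [boostCoeff, if_true]
      field_simp
      ring
    have := congrArg (fun x : ℝ ↦ (x : ℂ)) hr
    push_cast at this
    exact this
  have hBl : 2 * c 0 * B (e 0) v - ∑ i, c i * B (e i) v = (1 + u 0 : ℂ)⁻¹ * B v v := by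
    have := congrArg (fun w ↦ B w v) hsumc
    simpa [map_sub, map_sum, two_mul, add_mul] using this
  have hBr : 2 * c 0 * B v (e 0) - ∑ i, c i * B v (e i) = (1 + u 0 : ℂ)⁻¹ * B v v := by
    have := congrArg (fun w ↦ B v w) hsumc
    simpa [map_sub, map_sum, two_mul, add_mul] using this
  have hexp : ∀ i, B (e i - c i • v) (e i - c i • v) =
      B (e i) (e i) - c i * B (e i) v - c i * B v (e i) + c i ^ 2 * B v v := by
    intro i
    simp only [map_sub, map_smul, sub_apply, smul_apply,
      smul_eq_mul]
    ring
  simp only [hb, hexp, Finset.sum_add_distrib, Finset.sum_sub_distrib, ← Finset.sum_mul]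
  linear_combination -hBl - hBr + B v v * hsq

end LorentzAlgebra

lemma isOpen_tube (n : ℕ) [NeZero n] : IsOpen (tube n) := by
  have h1 : Continuous fun z : Fin n → ℂ ↦ lor (imP z) := by
    unfold lor imP
    fun_prop
  have h2 : Continuous fun z : Fin n → ℂ ↦ imP z 0 := by
    unfold imP
    fun_prop
  exact (isOpen_lt continuous_const h1).inter (isOpen_lt continuous_const h2)

/-- Powers of two comparable positive numbers are comparable. -/
lemma rpow_le_four_rpow_abs_mul {a b : ℝ} (ha : 0 < a) (hab : a / 4 ≤ b) (hba : b ≤ 4 * a)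
    (μ : ℝ) : b ^ μ ≤ 4 ^ |μ| * a ^ μ := by
  have hb : 0 < b := by linarith
  rcases le_total 0 μ with hμ | hμ
  · rw [abs_of_nonneg hμ, ← Real.mul_rpow (by norm_num) ha.le]
    exact Real.rpow_le_rpow hb.le hba hμ
  · rw [abs_of_nonpos hμ]
    calc b ^ μ ≤ (a / 4) ^ μ := Real.rpow_le_rpow_of_nonpos (by positivity) hab hμ
      _ = 4 ^ (-μ) * a ^ μ := by
        rw [Real.div_rpow ha.le (by norm_num), Real.rpow_neg (by norm_num)]
        field_simp

/-- Pointwise estimate for `□F` in terms of a weighted sup-norm bound for `F`. -/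
lemma norm_BoxOp_le {n : ℕ} [NeZero n] {ν m : ℝ} {F : (Fin n → ℂ) → ℂ}
    (hF : DifferentiableOn ℂ F (tube n)) (hm : ∀ w ∈ tube n, lor (imP w) ^ ν * ‖F w‖ ≤ m)
    {z : Fin n → ℂ} (hz : z ∈ tube n) :
    lor (imP z) ^ (ν + 1) * ‖BoxOp F z‖ ≤ (n + 2) * 8 * 4 ^ |ν| * m := by
  have hΔ : 0 < lor (imP z) := hz.1
  set s : ℝ := √(lor (imP z)) with hs
  have hs0 : 0 < s := Real.sqrt_pos.2 hΔ
  have hs2 : s ^ 2 = lor (imP z) := Real.sq_sqrt hΔ.le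
  set u : Fin n → ℝ := s⁻¹ • imP z with hu_def
  have hsu : s • u = imP z := by rw [hu_def, smul_inv_smul₀ hs0.ne']
  have hu : lor u = 1 := by
    rw [hu_def, lor_eq_lorInner, lorInner_smul_left, lorInner_smul_right, ← lor_eq_lorInner, ← hs2]
    field_simp
  have hu0 : 0 < u 0 := mul_pos (inv_pos.2 hs0) hz.2
  have him : ∀ i (ζ : ℂ), imP (z + ζ • fun j ↦ (boost u i j : ℂ)) = s • u + ζ.im • boost u i := by
    intro i ζ
    rw [hsu]
    ext j
    simp [imP]
  have hline : ∀ i (ζ : ℂ), ‖ζ‖ ≤ s / 2 → _ := fun i ζ hζ ↦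
    lor_add_smul_boost hu hu0 i hs0 ((Complex.abs_im_le_norm ζ).trans hζ)
  have hmem : ∀ i (ζ : ℂ), ‖ζ‖ ≤ s / 2 → z + ζ • (fun j ↦ (boost u i j : ℂ)) ∈ tube n := by
    intro i ζ hζ
    change imP _ ∈ cone n
    rw [him]
    exact (hline i ζ hζ).1
  set K : ℝ := 4 ^ |ν| * lor (imP z) ^ (-ν) * m with hK
  have hm0 : 0 ≤ m := (mul_nonneg (Real.rpow_nonneg hΔ.le _) (norm_nonneg _)).trans (hm z hz)
  have hFK : ∀ i (ζ : ℂ), ‖ζ‖ ≤ s / 2 → ‖F (z + ζ • fun j ↦ (boost u i j : ℂ))‖ ≤ K := by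
    intro i ζ hζ
    have hw := hmem i ζ hζ
    set w := z + ζ • fun j ↦ (boost u i j : ℂ)
    have hw0 : 0 < lor (imP w) := hw.1
    obtain ⟨-, h1, h2⟩ := hline i ζ hζ
    rw [← him, hs2] at h1 h2
    have h3 := rpow_le_four_rpow_abs_mul hΔ h1 h2 (-ν)
    rw [abs_neg] at h3
    calc ‖F w‖ = lor (imP w) ^ (-ν) * (lor (imP w) ^ ν * ‖F w‖) := by
          rw [← mul_assoc, ← Real.rpow_add hw0]; simp
      _ ≤ (4 ^ |ν| * lor (imP z) ^ (-ν)) * m :=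
          mul_le_mul h3 (hm w hw) (by positivity) (by positivity)
  set B := secondDeriv (isOpen_tube n) hF hz with hB
  have hBi : ∀ i, ‖B (fun j ↦ boost u i j) (fun j ↦ boost u i j)‖ ≤ 8 * K / lor (imP z) := by
    intro i
    refine (norm_secondDeriv_le (isOpen_tube n) hF hz _ (half_pos hs0) (hmem i) (hFK i)).trans
      (le_of_eq ?_)
    rw [← hs2]
    field_simp
    ring
  have hbox : BoxOp F z = -(2 * B (fun j ↦ boost u 0 j) (fun j ↦ boost u 0 j) -
      ∑ i, B (fun j ↦ boost u i j) (fun j ↦ boost u i j)) := by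
    rw [boost_trace B hu hu0]
    rfl
  have hnorm : ‖BoxOp F z‖ ≤ (n + 2) * (8 * K / lor (imP z)) := by
    rw [hbox, norm_neg]
    refine (norm_sub_le _ _).trans ?_
    have h1 := norm_sum_le_of_le Finset.univ fun i _ ↦ hBi i
    have h2 := hBi 0
    rw [Finset.sum_const, Finset.card_univ, Fintype.card_fin, nsmul_eq_mul] at h1
    rw [norm_mul, Complex.norm_ofNat]
    linarith
  calc lor (imP z) ^ (ν + 1) * ‖BoxOp F z‖
      ≤ lor (imP z) ^ (ν + 1) * ((n + 2) * (8 * K / lor (imP z))) := by gcongr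
    _ = (n + 2) * 8 * 4 ^ |ν| * m * (lor (imP z) ^ ν * lor (imP z) ^ (-ν)) := by
      rw [hK, Real.rpow_add_one hΔ.ne']
      field_simp
    _ = (n + 2) * 8 * 4 ^ |ν| * m := by
      rw [← Real.rpow_add hΔ]; simp

/-- Lemma: `sup_z Δ(Im z)^{ν+1} |□F(z)| ≤ C sup_z Δ(Im z)^ν |F(z)|`. -/
theorem bloch_mean_value (n : ℕ) [NeZero n] (hn : 3 ≤ n) (ν : ℝ) :
    ∃ C : ℝ, ∀ F : (Fin n → ℂ) → ℂ, DifferentiableOn ℂ F (tube n) →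
      (⨆ z ∈ tube n, ENNReal.ofReal (lor (imP z) ^ (ν + 1) * ‖BoxOp F z‖)) ≤
        ENNReal.ofReal C * ⨆ z ∈ tube n, ENNReal.ofReal (lor (imP z) ^ ν * ‖F z‖) := by
  have hC : (0 : ℝ) < (n + 2) * 8 * 4 ^ |ν| := by positivity
  refine ⟨(n + 2) * 8 * 4 ^ |ν|, fun F hF ↦ iSup₂_le fun z hz ↦ ?_⟩
  set M : ℝ≥0∞ := ⨆ z ∈ tube n, ENNReal.ofReal (lor (imP z) ^ ν * ‖F z‖) with hM
  by_cases hMtop : M = ⊤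
  · rw [hMtop, ENNReal.mul_top (ENNReal.ofReal_pos.2 hC).ne']
    exact le_top
  · have hm : ∀ w ∈ tube n, lor (imP w) ^ ν * ‖F w‖ ≤ M.toReal := fun w hw ↦
      (ENNReal.ofReal_le_iff_le_toReal hMtop).1
        (le_iSup₂ (f := fun w (_ : w ∈ tube n) ↦ ENNReal.ofReal (lor (imP w) ^ ν * ‖F w‖)) w hw)
    rw [← ENNReal.ofReal_toReal hMtop, ← ENNReal.ofReal_mul hC.le]
    exact ENNReal.ofReal_le_ofReal (norm_BoxOp_le hF hm hz)
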